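/- Let E_1,…,E_g be d×d quantum effects and set A = (A_1,…,A_g) with A_i = 2E_i − I. Then ‖A‖_c ≤ 1 if and only if E_1,…,E_g are compatible effects. -/

import Mathlib

open Matrix ComplexOrder

noncomputable section

/-- The largest eigenvalue of a (Hermitian) matrix, characterized via the Loewner order. -/
noncomputable def lambdaMax {d : ℕ} (M : Matrix (Fin d) (Fin d) ℂ) : ℝ :=
  sInf {t : ℝ | (t • (1 : Matrix (Fin d) (Fin d) ℂ) - M).PosSemidef}

/-- The compatibility norm `‖A‖_c`: infimum of `λ_max (∑ j, H j)` over finite decompositions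
`A i = ∑ j, z j i • H j` with `‖z j‖_∞ ≤ 1` and `H j` positive semidefinite. -/
noncomputable def cNorm {g d : ℕ} (A : Fin g → Matrix (Fin d) (Fin d) ℂ) : ℝ :=
  sInf {t : ℝ | ∃ (n : ℕ) (z : Fin n → Fin g → ℝ) (H : Fin n → Matrix (Fin d) (Fin d) ℂ),
    (∀ j i, |z j i| ≤ 1) ∧ (∀ j, (H j).PosSemidef) ∧
    (∀ i, A i = ∑ j, z j i • H j) ∧ t = lambdaMax (∑ j, H j)}

/-- A quantum effect: `0 ≤ E ≤ I` in the Loewner order. -/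
def IsEffect {d : ℕ} (E : Matrix (Fin d) (Fin d) ℂ) : Prop :=
  E.PosSemidef ∧ ((1 : Matrix (Fin d) (Fin d) ℂ) - E).PosSemidef

/-- Effects `E i` are compatible if the dichotomic POVMs `(E i, I - E i)` are jointly measurable:
there is a joint POVM `(K ε)` indexed by sign vectors with `E i = ∑_{ε : ε i = 1} K ε`. -/
def CompatibleEffects {g d : ℕ} (E : Fin g → Matrix (Fin d) (Fin d) ℂ) : Prop :=
  ∃ K : (Fin g → Bool) → Matrix (Fin d) (Fin d) ℂ,
    (∀ ε, (K ε).PosSemidef) ∧ (∑ ε, K ε = 1) ∧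
    ∀ i, E i = ∑ ε ∈ Finset.univ.filter (fun ε : Fin g → Bool => ε i = true), K ε

/-- The compatibility region `Γ(g, d)` for dichotomic measurements. -/
def GammaD (g d : ℕ) : Set (Fin g → ℝ) :=
  {s | (∀ i, s i ∈ Set.Icc (0 : ℝ) 1) ∧
    ∀ E : Fin g → Matrix (Fin d) (Fin d) ℂ, (∀ i, IsEffect (E i)) →
      CompatibleEffects (fun i => s i • E i +
        ((1 - s i) * (2 : ℝ)⁻¹) • (1 : Matrix (Fin d) (Fin d) ℂ))}

/-- The sign in `{-1, 1}` encoded by a Boolean. -/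
def boolSign (b : Bool) : ℝ := if b then 1 else -1

lemma abs_boolSign (b : Bool) : |boolSign b| = 1 := by
  cases b <;> simp [boolSign]

lemma sum_boolSign_smul {V : Type*} [AddCommGroup V] [Module ℝ V] {g : ℕ}
    (K : (Fin g → Bool) → V) (i : Fin g) :
    ∑ ε, boolSign (ε i) • K ε = (2 : ℝ) • ∑ ε with ε i = true, K ε - ∑ ε, K ε := by
  rw [Finset.smul_sum, Finset.sum_filter, ← Finset.sum_sub_distrib]
  refine Finset.sum_congr rfl fun ε _ => ?_
  cases ε i <;> simp [boolSign, two_smul]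

/-- A point of the cube `[-1, 1]^g` is a convex combination of its vertices. -/
lemma exists_vertex_weights {g : ℕ} (z : Fin g → ℝ) (hz : ∀ i, |z i| ≤ 1) :
    ∃ p : (Fin g → Bool) → ℝ, (∀ ε, 0 ≤ p ε) ∧ ∑ ε, p ε = 1 ∧
      ∀ i, ∑ ε, p ε * boolSign (ε i) = z i := by
  refine ⟨fun ε => ∏ k, (1 + boolSign (ε k) * z k) / 2, fun ε => ?_, ?_, fun i => ?_⟩
  · refine Finset.prod_nonneg fun k _ => ?_
    have := abs_le.1 (hz k)
    cases ε k <;> simp [boolSign] <;> linarith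
  · rw [← Fintype.prod_sum fun k b => (1 + boolSign b * z k) / 2]
    refine Finset.prod_eq_one fun k _ => ?_
    simp only [Fintype.sum_bool, boolSign, if_true, Bool.false_eq_true, if_false]
    ring
  · have h (ε : Fin g → Bool) : (∏ k, (1 + boolSign (ε k) * z k) / 2) * boolSign (ε i) =
        ∏ k, (1 + boolSign (ε k) * z k) / 2 * if k = i then boolSign (ε k) else 1 := by
      rw [Finset.prod_mul_distrib, Finset.prod_ite_eq' Finset.univ i]
      simp
    simp_rw [h]
    rw [← Fintype.prod_sum fun k b =>
      (1 + boolSign b * z k) / 2 * if k = i then boolSign b else 1]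
    rw [Finset.prod_eq_single i]
    · simp only [Fintype.sum_bool, boolSign, if_true, Bool.false_eq_true, if_false]
      ring
    · intro k _ hk
      simp only [Fintype.sum_bool, boolSign, if_true, Bool.false_eq_true, if_false, hk]
      ring
    · simp

/-- A decomposition over points of the cube can be rewritten over the vertices of the cube. -/
lemma exists_sign_decomposition {g d n : ℕ} (z : Fin n → Fin g → ℝ)
    (H : Fin n → Matrix (Fin d) (Fin d) ℂ) (hz : ∀ j i, |z j i| ≤ 1)
    (hH : ∀ j, (H j).PosSemidef) :
    ∃ K : (Fin g → Bool) → Matrix (Fin d) (Fin d) ℂ, (∀ ε, (K ε).PosSemidef) ∧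
      ∑ ε, K ε = ∑ j, H j ∧ ∀ i, ∑ ε, boolSign (ε i) • K ε = ∑ j, z j i • H j := by
  choose p hp hp1 hpz using fun j => exists_vertex_weights (z j) (hz j)
  refine ⟨fun ε => ∑ j, p j ε • H j, fun ε => ?_, ?_, fun i => ?_⟩
  · exact posSemidef_sum _ fun j _ => (hH j).smul (hp j ε)
  · rw [Finset.sum_comm]
    simp_rw [← Finset.sum_smul, hp1, one_smul]
  · simp_rw [Finset.smul_sum, smul_smul]
    rw [Finset.sum_comm]
    simp_rw [← Finset.sum_smul, mul_comm (boolSign _), hpz]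

/-- A sub-normalized sign decomposition of `2 E i - I` yields a joint measurement. -/
lemma compatibleEffects_of_sign_decomposition {g d : ℕ} {E : Fin g → Matrix (Fin d) (Fin d) ℂ}
    (K : (Fin g → Bool) → Matrix (Fin d) (Fin d) ℂ) (hK : ∀ ε, (K ε).PosSemidef)
    (hsum : (1 - ∑ ε, K ε).PosSemidef)
    (hE : ∀ i, ∑ ε, boolSign (ε i) • K ε = (2 : ℝ) • E i - 1) : CompatibleEffects E := by
  set R := 1 - ∑ ε, K ε with hR
  have hR2 : ((2 : ℝ)⁻¹ • R).PosSemidef := hsum.smul (by norm_num)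
  let L : (Fin g → Bool) → Matrix (Fin d) (Fin d) ℂ := fun ε =>
    (if ε = (fun _ => true) then (2 : ℝ)⁻¹ • R else 0) +
      if ε = (fun _ => false) then (2 : ℝ)⁻¹ • R else 0
  have hL1 : ∑ ε, L ε = R := by
    simp only [L, Finset.sum_add_distrib, Finset.sum_ite_eq', Finset.mem_univ, if_true]
    rw [← add_smul]
    norm_num
  have hL0 (i : Fin g) : ∑ ε, boolSign (ε i) • L ε = 0 := by
    simp only [L, smul_add, smul_ite, smul_zero, Finset.sum_add_distrib, Finset.sum_ite_eq',
      Finset.mem_univ, if_true]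
    simp [boolSign]
  have hKL1 : ∑ ε, (K ε + L ε) = 1 := by
    rw [Finset.sum_add_distrib, hL1, hR, add_sub_cancel]
  refine ⟨fun ε => K ε + L ε, fun ε => (hK ε).add (.add ?_ ?_), hKL1, fun i => ?_⟩
  · split_ifs
    exacts [hR2, .zero]
  · split_ifs
    exacts [hR2, .zero]
  · have hsign : ∑ ε, boolSign (ε i) • (K ε + L ε) = (2 : ℝ) • E i - 1 := by
      simp_rw [smul_add]
      rw [Finset.sum_add_distrib, hL0, hE, add_zero]
    rw [sum_boolSign_smul, hKL1] at hsign
    exact smul_right_injective _ (two_ne_zero (α := ℝ)) (sub_left_injective hsign).symm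

lemma isClosed_posSemidef (d : ℕ) : IsClosed {M : Matrix (Fin d) (Fin d) ℂ | M.PosSemidef} := by
  simp_rw [posSemidef_iff_dotProduct_mulVec, IsHermitian, Set.ofPred_and, Set.ofPred_forall]
  refine (isClosed_eq (by fun_prop) (by fun_prop)).inter
    (isClosed_iInter fun x => isClosed_le (by fun_prop) (by fun_prop))

section LoewnerOrder

open scoped MatrixOrder Matrix.Norms.L2Operator

lemma exists_smul_one_sub_posSemidef {d : ℕ} {M : Matrix (Fin d) (Fin d) ℂ}
    (hM : M.IsHermitian) : ∃ t : ℝ, (t • (1 : Matrix (Fin d) (Fin d) ℂ) - M).PosSemidef := by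
  have h := IsSelfAdjoint.le_algebraMap_norm_self (a := M) hM
  rw [Algebra.algebraMap_eq_smul_one, le_iff] at h
  exact ⟨_, h⟩

lemma isCompact_subnormalized {ι : Type*} [Fintype ι] (d : ℕ) (t : ℝ) :
    IsCompact {K : ι → Matrix (Fin d) (Fin d) ℂ | (∀ i, (K i).PosSemidef) ∧
      (t • (1 : Matrix (Fin d) (Fin d) ℂ) - ∑ i, K i).PosSemidef} := by
  refine (isCompact_univ_pi fun _ : ι => isCompact_closedBall
    (0 : Matrix (Fin d) (Fin d) ℂ) ‖t • (1 : Matrix (Fin d) (Fin d) ℂ)‖).of_isClosed_subset ?_ ?_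
  · rw [Set.ofPred_and, Set.ofPred_forall]
    have hcont : Continuous fun K : ι → Matrix (Fin d) (Fin d) ℂ =>
        t • (1 : Matrix (Fin d) (Fin d) ℂ) - ∑ i, K i := by fun_prop
    exact (isClosed_iInter fun i => (isClosed_posSemidef d).preimage (continuous_apply i)).inter
      ((isClosed_posSemidef d).preimage hcont)
  · rintro K ⟨hK, hKt⟩ i -
    rw [mem_closedBall_zero_iff]
    refine CStarAlgebra.norm_le_norm_of_nonneg_of_le (hK i).nonneg (le_trans ?_ (le_iff.2 hKt))
    exact Finset.single_le_sum (f := K) (fun j _ => (hK j).nonneg) (Finset.mem_univ i)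

end LoewnerOrder

lemma smul_one_sub_posSemidef_of_le {d : ℕ} {M : Matrix (Fin d) (Fin d) ℂ} {s t : ℝ}
    (h : (s • (1 : Matrix (Fin d) (Fin d) ℂ) - M).PosSemidef) (hst : s ≤ t) :
    (t • (1 : Matrix (Fin d) (Fin d) ℂ) - M).PosSemidef := by
  have := h.add ((PosSemidef.one (n := Fin d) (R := ℂ)).smul (sub_nonneg.2 hst))
  rwa [sub_smul, sub_add_sub_cancel'] at this

lemma nonneg_of_smul_one_sub_posSemidef {d : ℕ} [NeZero d] {M : Matrix (Fin d) (Fin d) ℂ}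
    (hM : M.PosSemidef) {t : ℝ} (h : (t • (1 : Matrix (Fin d) (Fin d) ℂ) - M).PosSemidef) :
    0 ≤ t := by
  have := (h.add hM).diag_nonneg (i := 0)
  simpa using this

lemma lambdaMax_of_dim_zero (M : Matrix (Fin 0) (Fin 0) ℂ) : lambdaMax M = 0 := by
  have h (t : ℝ) : (t • (1 : Matrix (Fin 0) (Fin 0) ℂ) - M).PosSemidef := by
    rw [Subsingleton.elim (t • (1 : Matrix (Fin 0) (Fin 0) ℂ) - M) 0]
    exact .zero
  simp [lambdaMax, h]

lemma lambdaMax_nonneg {d : ℕ} {M : Matrix (Fin d) (Fin d) ℂ} (hM : M.PosSemidef) :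
    0 ≤ lambdaMax M := by
  rcases d.eq_zero_or_pos with rfl | hd
  · rw [lambdaMax_of_dim_zero]
  · have : NeZero d := ⟨hd.ne'⟩
    exact Real.sInf_nonneg fun t ht => nonneg_of_smul_one_sub_posSemidef hM ht

lemma lambdaMax_le {d : ℕ} {M : Matrix (Fin d) (Fin d) ℂ} (hM : M.PosSemidef) {t : ℝ}
    (ht : 0 ≤ t) (h : (t • (1 : Matrix (Fin d) (Fin d) ℂ) - M).PosSemidef) :
    lambdaMax M ≤ t := by
  rcases d.eq_zero_or_pos with rfl | hd
  · rwa [lambdaMax_of_dim_zero]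
  · have : NeZero d := ⟨hd.ne'⟩
    exact csInf_le ⟨0, fun s hs => nonneg_of_smul_one_sub_posSemidef hM hs⟩ h

lemma lambdaMax_smul_one_sub_posSemidef {d : ℕ} {M : Matrix (Fin d) (Fin d) ℂ}
    (hM : M.PosSemidef) : (lambdaMax M • (1 : Matrix (Fin d) (Fin d) ℂ) - M).PosSemidef := by
  rcases d.eq_zero_or_pos with rfl | hd
  · rw [Subsingleton.elim (_ - M) 0]
    exact .zero
  · have : NeZero d := ⟨hd.ne'⟩
    have hc : IsClosed {t : ℝ | (t • (1 : Matrix (Fin d) (Fin d) ℂ) - M).PosSemidef} :=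
      (isClosed_posSemidef d).preimage (by fun_prop)
    exact hc.csInf_mem (exists_smul_one_sub_posSemidef hM.isHermitian)
      ⟨0, fun s hs => nonneg_of_smul_one_sub_posSemidef hM hs⟩

/-- The parameters `t` for which `A` has a sign decomposition with total weight at most `t I`
form a closed set below any bound. -/
lemma isClosed_sign_decomposition_bounds {g d : ℕ} (A : Fin g → Matrix (Fin d) (Fin d) ℂ)
    (b : ℝ) :
    IsClosed {t : ℝ | t ≤ b ∧ ∃ K : (Fin g → Bool) → Matrix (Fin d) (Fin d) ℂ,
      (∀ ε, (K ε).PosSemidef) ∧ (t • (1 : Matrix (Fin d) (Fin d) ℂ) - ∑ ε, K ε).PosSemidef ∧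
        ∀ i, ∑ ε, boolSign (ε i) • K ε = A i} := by
  have hC := isCompact_subnormalized (ι := Fin g → Bool) d b
  have hS : IsClosed {p : ℝ × ((Fin g → Bool) → Matrix (Fin d) (Fin d) ℂ) | p.1 ≤ b ∧
      (p.1 • (1 : Matrix (Fin d) (Fin d) ℂ) - ∑ ε, p.2 ε).PosSemidef ∧
        ∀ i, ∑ ε, boolSign (ε i) • p.2 ε = A i} := by
    simp_rw [Set.ofPred_and, Set.ofPred_forall]
    exact (isClosed_le (by fun_prop) (by fun_prop)).inter
      (((isClosed_posSemidef d).preimage (by fun_prop)).inter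
        (isClosed_iInter fun i => isClosed_eq (by fun_prop) (by fun_prop)))
  have hcompact := isCompact_iff_compactSpace.1 hC
  have hT := isClosedMap_fst_of_compactSpace (X := ℝ) (Y := _) _
    (hS.preimage (f := Prod.map id (Subtype.val :
      {K : (Fin g → Bool) → Matrix (Fin d) (Fin d) ℂ | (∀ ε, (K ε).PosSemidef) ∧
        (b • (1 : Matrix (Fin d) (Fin d) ℂ) - ∑ ε, K ε).PosSemidef} → _)) (by fun_prop))
  convert hT using 1
  ext t
  constructor
  · rintro ⟨htb, K, hK, hKt, hKA⟩
    exact ⟨(t, ⟨K, hK, smul_one_sub_posSemidef_of_le hKt htb⟩), ⟨htb, hKt, hKA⟩, rfl⟩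
  · rintro ⟨⟨s, K, hK, _⟩, ⟨hsb, hKs, hKA⟩, rfl⟩
    exact ⟨hsb, K, hK, hKs, hKA⟩

lemma bddBelow_cNorm_set {g d : ℕ} (A : Fin g → Matrix (Fin d) (Fin d) ℂ) :
    BddBelow {t : ℝ | ∃ (n : ℕ) (z : Fin n → Fin g → ℝ) (H : Fin n → Matrix (Fin d) (Fin d) ℂ),
      (∀ j i, |z j i| ≤ 1) ∧ (∀ j, (H j).PosSemidef) ∧
      (∀ i, A i = ∑ j, z j i • H j) ∧ t = lambdaMax (∑ j, H j)} := by
  refine ⟨0, ?_⟩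
  rintro t ⟨n, z, H, -, hH, -, rfl⟩
  exact lambdaMax_nonneg (posSemidef_sum _ fun j _ => hH j)

/-- Every tuple of differences of positive semidefinite matrices has a decomposition as in the
definition of the compatibility norm. -/
lemma exists_cNorm_decomposition {g d : ℕ} (P Q : Fin g → Matrix (Fin d) (Fin d) ℂ)
    (hP : ∀ i, (P i).PosSemidef) (hQ : ∀ i, (Q i).PosSemidef) :
    ∃ (n : ℕ) (z : Fin n → Fin g → ℝ) (H : Fin n → Matrix (Fin d) (Fin d) ℂ),
      (∀ j i, |z j i| ≤ 1) ∧ (∀ j, (H j).PosSemidef) ∧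
      ∀ i, P i - Q i = ∑ j, z j i • H j := by
  refine ⟨g + g, Fin.append (fun k i => if k = i then 1 else 0) (fun k i => if k = i then -1 else 0),
    Fin.append P Q, fun j i => ?_, fun j => ?_, fun i => ?_⟩
  · refine Fin.addCases (fun k => ?_) (fun k => ?_) j
    · simp only [Fin.append_left]
      split_ifs <;> simp
    · simp only [Fin.append_right]
      split_ifs <;> simp
  · refine Fin.addCases (fun k => ?_) (fun k => ?_) j
    · rw [Fin.append_left]
      exact hP k
    · rw [Fin.append_right]
      exact hQ k
  · simp only [Fin.sum_univ_add, Fin.append_left, Fin.append_right]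
    simp [ite_smul, sub_eq_add_neg]

/-- The infimum defining the compatibility norm is attained by a sign decomposition. -/
lemma exists_sign_decomposition_of_cNorm_le_one {g d : ℕ}
    (P Q : Fin g → Matrix (Fin d) (Fin d) ℂ)
    (hP : ∀ i, (P i).PosSemidef) (hQ : ∀ i, (Q i).PosSemidef)
    (h : cNorm (fun i => P i - Q i) ≤ 1) :
    ∃ K : (Fin g → Bool) → Matrix (Fin d) (Fin d) ℂ, (∀ ε, (K ε).PosSemidef) ∧
      (1 - ∑ ε, K ε).PosSemidef ∧ ∀ i, ∑ ε, boolSign (ε i) • K ε = P i - Q i := by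
  have hclosed := isClosed_sign_decomposition_bounds (fun i => P i - Q i) 2
  have hone : (1 : ℝ) ∈ closure (Set.Ioo (1 : ℝ) 2) := by
    rw [closure_Ioo (by norm_num)]
    norm_num
  have hsub (t : ℝ) (ht : t ∈ Set.Ioo (1 : ℝ) 2) :
      ∃ K : (Fin g → Bool) → Matrix (Fin d) (Fin d) ℂ, (∀ ε, (K ε).PosSemidef) ∧
        (t • (1 : Matrix (Fin d) (Fin d) ℂ) - ∑ ε, K ε).PosSemidef ∧
          ∀ i, ∑ ε, boolSign (ε i) • K ε = P i - Q i := by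
    obtain ⟨n, z, H, hz, hH, hA⟩ := exists_cNorm_decomposition P Q hP hQ
    obtain ⟨s, ⟨n, z, H, hz, hH, hA, rfl⟩, hst⟩ :=
      (csInf_lt_iff (bddBelow_cNorm_set _) ⟨_, n, z, H, hz, hH, hA, rfl⟩).1 (h.trans_lt ht.1)
    obtain ⟨K, hK, hKs, hKz⟩ := exists_sign_decomposition z H hz hH
    refine ⟨K, hK, ?_, fun i => (hKz i).trans (hA i).symm⟩
    rw [hKs]
    exact smul_one_sub_posSemidef_of_le
      (lambdaMax_smul_one_sub_posSemidef (posSemidef_sum _ fun j _ => hH j)) hst.le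
  obtain ⟨-, K, hK, hK1, hKA⟩ :=
    hclosed.closure_subset_iff.2 (fun t ht => And.intro ht.2.le (hsub t ht)) hone
  exact ⟨K, hK, by simpa using hK1, hKA⟩

lemma cNorm_le_one_of_compatibleEffects {g d : ℕ} {E : Fin g → Matrix (Fin d) (Fin d) ℂ}
    (h : CompatibleEffects E) : cNorm (fun i => (2 : ℝ) • E i - 1) ≤ 1 := by
  obtain ⟨K, hK, hK1, hKE⟩ := h
  let e := (Fintype.equivFin (Fin g → Bool)).symm
  have hsum : ∑ j, K (e j) = 1 := by rw [e.sum_comp K, hK1]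
  refine (csInf_le (bddBelow_cNorm_set _) ⟨_, fun j i => boolSign (e j i), fun j => K (e j),
    fun j i => ?_, fun j => hK _, fun i => ?_, rfl⟩).trans ?_
  · exact (abs_boolSign _).le
  · rw [e.sum_comp fun ε => boolSign (ε i) • K ε, sum_boolSign_smul, hK1, hKE]
  · rw [hsum]
    exact lambdaMax_le .one zero_le_one (by simpa using PosSemidef.zero)

/-- For effects `E i` and `A i = 2 E i - I`, `‖A‖_c ≤ 1` iff the `E i` are
compatible. -/
theorem cNorm_le_one_iff_compatible (g d : ℕ)
    (E : Fin g → Matrix (Fin d) (Fin d) ℂ) (hE : ∀ i, IsEffect (E i)) :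
    cNorm (fun i => (2 : ℝ) • E i - 1) ≤ 1 ↔ CompatibleEffects E := by
  refine ⟨fun h => ?_, cNorm_le_one_of_compatibleEffects⟩
  have hA (i : Fin g) : (2 : ℝ) • E i - 1 = E i - (1 - E i) := by
    rw [two_smul]
    abel
  simp_rw [hA] at h
  obtain ⟨K, hK, hK1, hKA⟩ :=
    exists_sign_decomposition_of_cNorm_le_one _ _ (fun i => (hE i).1) (fun i => (hE i).2) h
  exact compatibleEffects_of_sign_decomposition K hK hK1 fun i => (hKA i).trans (hA i).symm
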